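/- arXiv:2202.09905 — 15 statements merged into one kernel-verified Lean document; each statement's English description precedes it below -/
import Mathlib

section
/- For every α ∈ (0,1) and c > 0, the Cobb-Douglas monomorphic utility U attains its maximum over (0,∞) at Ropt = max(1/c, 1/(1−α)); that is, U(R) ≤ U(Ropt) for all R > 0, and Ropt is the unique maximizer. -/
/-- The Cobb-Douglas monomorphic utility as a function of the good-contagion
reproduction number `R`, with weight `α` on the good contagion and relative
transmissibility `c` of the bad contagion:
`U(R) = 0` for `R ≤ 1`, `U(R) = (1 − 1/R)^α` for `1 ≤ R ≤ 1/c`, and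
`U(R) = (1 − 1/R)^α · (1/(c·R))^(1−α)` for `R ≥ max(1, 1/c)`. -/
noncomputable def cobbDouglasUtility (α c R : ℝ) : ℝ :=
  if R ≤ 1 then 0
  else if R ≤ 1 / c then (1 - 1 / R) ^ α
  else (1 - 1 / R) ^ α * (1 / (c * R)) ^ (1 - α)

lemma cd_key (α c x y : ℝ) (h0 : 0 < α) (h1 : α < 1) (hc : 0 < c) (hx : 0 < x) (hx1 : x < 1)
    (hy : 0 < y) (hy1 : y < 1) (hne : x ≠ y) (h : (y - x) * (y - (1 - α)) ≤ 0) :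
    (1 - x) ^ α * (x / c) ^ (1 - α) < (1 - y) ^ α * (y / c) ^ (1 - α) := by
  have hx' : 0 < 1 - x := by linarith
  have hy' : 0 < 1 - y := by linarith
  rw [Real.rpow_def_of_pos hx', Real.rpow_def_of_pos hy', Real.rpow_def_of_pos (by positivity),
    Real.rpow_def_of_pos (by positivity), ← Real.exp_add, ← Real.exp_add, Real.exp_lt_exp,
    Real.log_div hx.ne' hc.ne', Real.log_div hy.ne' hc.ne']
  have e1 := Real.log_lt_sub_one_of_pos (x := x / y) (by positivity)
    (by rw [Ne, div_eq_one_iff_eq hy.ne']; exact hne)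
  have e2 := Real.log_le_sub_one_of_pos (x := (1 - x) / (1 - y)) (by positivity)
  rw [Real.log_div hx.ne' hy.ne'] at e1
  rw [Real.log_div hx'.ne' hy'.ne'] at e2
  have e3 : α * ((1 - x) / (1 - y) - 1) + (1 - α) * (x / y - 1)
      = ((y - x) * (y - (1 - α))) / (y * (1 - y)) := by
    field_simp
    ring
  have e4 : ((y - x) * (y - (1 - α))) / (y * (1 - y)) ≤ 0 :=
    div_nonpos_of_nonpos_of_nonneg h (by positivity)
  have e5 := mul_lt_mul_of_pos_left e1 (sub_pos.2 h1)
  have e6 := mul_le_mul_of_nonneg_left e2 h0.le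
  nlinarith

lemma cd_strict (α c : ℝ) (hα : α ∈ Set.Ioo (0 : ℝ) 1) (hc : 0 < c) (R : ℝ) (hR : 0 < R)
    (hne : R ≠ max (1 / c) (1 / (1 - α))) :
    cobbDouglasUtility α c R < cobbDouglasUtility α c (max (1 / c) (1 / (1 - α))) := by
  obtain ⟨h0, h1⟩ := hα
  have hb : 0 < 1 - α := by linarith
  set S := max (1 / c) (1 / (1 - α)) with hS
  have hSc : 1 / c ≤ S := le_max_left _ _
  have hSa : 1 / (1 - α) ≤ S := le_max_right _ _
  have hS1 : 1 < S := lt_of_lt_of_le (by rw [lt_div_iff₀ hb]; linarith) hSa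
  have hS0 : 0 < S := by linarith
  have hy0 : 0 < 1 / S := by positivity
  have hy1 : 1 / S < 1 := by rw [div_lt_one hS0]; exact hS1
  have hya : 1 / S ≤ 1 - α := by rw [one_div_le hS0 hb]; exact hSa
  have hScase : S = 1 / c ∨ 1 / S = 1 - α := by
    rcases max_choice (1 / c) (1 / (1 - α)) with h | h
    · left; rw [hS, h]
    · right; rw [hS, h, one_div_one_div]
  have hUS : cobbDouglasUtility α c S = (1 - 1 / S) ^ α * (1 / S / c) ^ (1 - α) := by
    unfold cobbDouglasUtility
    rw [if_neg (not_le.2 hS1)]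
    split_ifs with h
    · have : S = 1 / c := le_antisymm h hSc
      have h2 : 1 / S / c = 1 := by rw [this]; field_simp
      rw [h2, Real.one_rpow, mul_one]
    · congr 2
      field_simp
  have W : ∀ x, 0 < x → x < 1 → x ≤ c → x ≠ 1 / S →
      (1 - x) ^ α * (x / c) ^ (1 - α) < (1 - 1 / S) ^ α * (1 / S / c) ^ (1 - α) := by
    intro x hx hx1 hxc hxS
    apply cd_key α c x (1 / S) h0 h1 hc hx hx1 hy0 hy1 hxS
    rcases hScase with h | h
    · have : 1 / S = c := by rw [h, one_div_one_div]
      exact mul_nonpos_of_nonneg_of_nonpos (by linarith) (by linarith)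
    · rw [h]; simp
  rw [hUS]
  unfold cobbDouglasUtility
  split_ifs with hR1 hRc
  · have : 0 < 1 - 1 / S := by linarith
    positivity
  · push Not at hR1
    have hxpos : 0 < 1 - 1 / R := by
      have : 1 / R < 1 := by rw [div_lt_one hR]; exact hR1
      linarith
    have hcR : c ≤ 1 / R := by rw [le_one_div hc hR]; exact hRc
    have hcc : c / c = 1 := div_self hc.ne'
    by_cases hcS : c = 1 / S
    · rw [← hcS, hcc, Real.one_rpow, mul_one]
      apply Real.rpow_lt_rpow hxpos.le _ h0
      have : c ≠ 1 / R := by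
        intro h
        apply hne
        rw [← one_div_one_div R, ← h, hcS, one_div_one_div]
      have := lt_of_le_of_ne hcR this
      linarith
    · have := W c hc (by linarith) le_rfl hcS
      rw [hcc, Real.one_rpow, mul_one] at this
      refine lt_of_le_of_lt ?_ this
      exact Real.rpow_le_rpow hxpos.le (by linarith) h0.le
  · push Not at hR1 hRc
    have e : 1 / (c * R) = 1 / R / c := by field_simp
    rw [e]
    apply W
    · positivity
    · rw [div_lt_one hR]; exact hR1
    · rw [one_div_le hR hc]; exact hRc.le
    · intro h
      apply hne
      rw [← one_div_one_div R, h, one_div_one_div]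

/-- For every `α ∈ (0,1)` and `c > 0`, the Cobb-Douglas monomorphic utility
attains its maximum over `(0,∞)` at `Ropt = max(1/c, 1/(1−α))`, and `Ropt`
is the unique maximizer. -/
theorem cobbDouglas_social_optimum (α c : ℝ) (hα : α ∈ Set.Ioo (0 : ℝ) 1)
    (hc : 0 < c) :
    (∀ R : ℝ, 0 < R →
      cobbDouglasUtility α c R ≤ cobbDouglasUtility α c (max (1 / c) (1 / (1 - α)))) ∧
    (∀ R : ℝ, 0 < R → R ≠ max (1 / c) (1 / (1 - α)) →
      cobbDouglasUtility α c R < cobbDouglasUtility α c (max (1 / c) (1 / (1 - α)))) := by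
  refine ⟨fun R hR => ?_, fun R hR hne => cd_strict α c hα hc R hR hne⟩
  by_cases h : R = max (1 / c) (1 / (1 - α))
  · rw [← h]
  · exact (cd_strict α c hα hc R hR h).le
end

section
/- Let f ∈ (0,1), 0 < Rr < 1 and Rm ≥ 0. Then Rnet > 1 if and only if Rm > 1/2 + √(1/4 + ((1−f)/f)·Rr·(1 − Rr)). -/
/-- The net reproduction number of the two-strategy SIS model. -/
noncomputable def netReproductionNumber (f Rm Rr : ℝ) : ℝ :=
  (f * Rm ^ 2 + (1 - f) * Rr ^ 2) / (f * Rm + (1 - f) * Rr)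

/-- For `f ∈ (0,1)`, `0 < Rr < 1` and `Rm ≥ 0`, the contagion can invade
(`Rnet > 1`) iff `Rm > 1/2 + √(1/4 + ((1−f)/f)·Rr·(1 − Rr))`. -/
theorem rnet_gt_one_iff_mutant_threshold (f Rm Rr : ℝ)
    (hf : f ∈ Set.Ioo (0 : ℝ) 1) (hRr0 : 0 < Rr) (hRr1 : Rr < 1) (hRm : 0 ≤ Rm) :
    1 < netReproductionNumber f Rm Rr ↔
      1 / 2 + Real.sqrt (1 / 4 + ((1 - f) / f) * Rr * (1 - Rr)) < Rm := by
  obtain ⟨hf0, hf1⟩ := hf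
  have h1f : 0 < 1 - f := by linarith
  have h1r : 0 < 1 - Rr := by linarith
  have hden : 0 < f * Rm + (1 - f) * Rr := by positivity
  obtain ⟨c, hc⟩ : ∃ c, c = ((1 - f) / f) * Rr * (1 - Rr) := ⟨_, rfl⟩
  have hc0 : 0 < c := by rw [hc]; positivity
  have hfc : f * c = (1 - f) * Rr * (1 - Rr) := by rw [hc]; field_simp
  rw [← hc]
  have hA : 1 < netReproductionNumber f Rm Rr ↔ c < Rm ^ 2 - Rm := by
    unfold netReproductionNumber
    rw [one_lt_div hden, ← mul_lt_mul_iff_right₀ (b := c) hf0, hfc]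
    constructor <;> intro h <;> nlinarith
  rw [hA, ← lt_sub_iff_add_lt']
  constructor
  · intro h
    have hR : 1 < Rm := by nlinarith
    rw [Real.sqrt_lt' (by linarith)]
    nlinarith
  · intro h
    have hpos : 0 < Rm - 1 / 2 := lt_of_le_of_lt (Real.sqrt_nonneg _) h
    rw [Real.sqrt_lt' hpos] at h
    nlinarith
end

section
/- Fix positive reals Rm, Rr and f ∈ (0,1). The map Λ ↦ G(Λ, f) has a fixed point in (0,∞) if and only if Rnet(f) := (f·Rm² + (1−f)·Rr²)/(f·Rm + (1−f)·Rr) > 1; when it exists, this positive fixed point is unique, and when Rnet(f) ≤ 1 the only fixed point of G(·, f) in [0,∞) is Λ = 0. -/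
/-- The equilibrium map of the two-strategy SIS contagion dynamics:
`G(Λ, f) = (f·Rm·Im(Λ) + (1−f)·Rr·Ir(Λ))/(f·Rm + (1−f)·Rr)` where
`Im(Λ) = Rm·Λ/(1 + Rm·Λ)` and `Ir(Λ) = Rr·Λ/(1 + Rr·Λ)`. -/
noncomputable def Gmap (Rm Rr Λ f : ℝ) : ℝ :=
  (f * Rm * (Rm * Λ / (1 + Rm * Λ)) + (1 - f) * Rr * (Rr * Λ / (1 + Rr * Λ))) /
    (f * Rm + (1 - f) * Rr)

/-- The reduced equation for positive fixed points. -/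
lemma Gmap_fixed_iff (Rm Rr f Λ : ℝ) (hRm : 0 < Rm) (hRr : 0 < Rr) (h0 : 0 < f) (h1 : 0 < 1 - f)
    (hΛ : 0 < Λ) : Gmap Rm Rr Λ f = Λ ↔
      f * Rm ^ 2 / (1 + Rm * Λ) + (1 - f) * Rr ^ 2 / (1 + Rr * Λ) = f * Rm + (1 - f) * Rr := by
  have hs : 0 < f * Rm + (1 - f) * Rr := by positivity
  have e : f * Rm * (Rm * Λ / (1 + Rm * Λ)) + (1 - f) * Rr * (Rr * Λ / (1 + Rr * Λ)) =
      Λ * (f * Rm ^ 2 / (1 + Rm * Λ) + (1 - f) * Rr ^ 2 / (1 + Rr * Λ)) := by ring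
  unfold Gmap
  rw [div_eq_iff hs.ne', e]
  exact mul_right_inj' hΛ.ne'

/-- The reduced map is strictly decreasing on nonnegative reals. -/
lemma reduced_lt (Rm Rr f s t : ℝ) (hRm : 0 < Rm) (hRr : 0 < Rr) (h0 : 0 < f) (h1 : 0 < 1 - f)
    (hs : 0 ≤ s) (hst : s < t) :
    f * Rm ^ 2 / (1 + Rm * t) + (1 - f) * Rr ^ 2 / (1 + Rr * t) <
      f * Rm ^ 2 / (1 + Rm * s) + (1 - f) * Rr ^ 2 / (1 + Rr * s) := by
  have a : Rm * s < Rm * t := mul_lt_mul_of_pos_left hst hRm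
  have b : Rr * s < Rr * t := mul_lt_mul_of_pos_left hst hRr
  apply add_lt_add
  · exact div_lt_div_of_pos_left (by positivity) (by positivity) (by linarith)
  · exact div_lt_div_of_pos_left (by positivity) (by positivity) (by linarith)

/-- Fix positive reals `Rm, Rr` and `f ∈ (0,1)`.  The map `Λ ↦ G(Λ, f)` has a
fixed point in `(0,∞)` iff `Rnet(f) = (f·Rm² + (1−f)·Rr²)/(f·Rm + (1−f)·Rr) > 1`;
the positive fixed point is unique when it exists; and when `Rnet(f) ≤ 1` the
only fixed point in `[0,∞)` is `Λ = 0`. -/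
theorem endemic_equilibrium_existence_uniqueness (Rm Rr : ℝ)
    (hRm : 0 < Rm) (hRr : 0 < Rr) (f : ℝ) (hf : f ∈ Set.Ioo (0 : ℝ) 1) :
    ((∃ Λ : ℝ, 0 < Λ ∧ Gmap Rm Rr Λ f = Λ) ↔
      1 < (f * Rm ^ 2 + (1 - f) * Rr ^ 2) / (f * Rm + (1 - f) * Rr)) ∧
    (∀ Λ₁ Λ₂ : ℝ, 0 < Λ₁ → 0 < Λ₂ →
      Gmap Rm Rr Λ₁ f = Λ₁ → Gmap Rm Rr Λ₂ f = Λ₂ → Λ₁ = Λ₂) ∧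
    ((f * Rm ^ 2 + (1 - f) * Rr ^ 2) / (f * Rm + (1 - f) * Rr) ≤ 1 →
      ∀ Λ : ℝ, 0 ≤ Λ → Gmap Rm Rr Λ f = Λ → Λ = 0) := by
  obtain ⟨h0, h1'⟩ := hf
  have h1 : 0 < 1 - f := by linarith
  have hs : 0 < f * Rm + (1 - f) * Rr := by positivity
  have only : ∀ Λ : ℝ, 0 < Λ → Gmap Rm Rr Λ f = Λ →
      1 < (f * Rm ^ 2 + (1 - f) * Rr ^ 2) / (f * Rm + (1 - f) * Rr) := by
    intro Λ hΛ h
    rw [Gmap_fixed_iff Rm Rr f Λ hRm hRr h0 h1 hΛ] at h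
    have h2 := reduced_lt Rm Rr f 0 Λ hRm hRr h0 h1 le_rfl hΛ
    rw [h] at h2
    rw [one_lt_div hs]
    simpa using h2
  refine ⟨⟨fun ⟨Λ, hΛ, h⟩ => only Λ hΛ h, fun h => ?_⟩, ?_, ?_⟩
  · rw [one_lt_div hs] at h
    have hc : ContinuousOn (fun t : ℝ => f * Rm ^ 2 / (1 + Rm * t) +
        (1 - f) * Rr ^ 2 / (1 + Rr * t)) (Set.Icc 0 1) := by
      apply ContinuousOn.add
      · apply ContinuousOn.div (by fun_prop) (by fun_prop)
        intro t ht
        have := mul_nonneg hRm.le ht.1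
        positivity
      · apply ContinuousOn.div (by fun_prop) (by fun_prop)
        intro t ht
        have := mul_nonneg hRr.le ht.1
        positivity
    have hI := intermediate_value_Ioo' (zero_le_one) hc
    have hm : f * Rm + (1 - f) * Rr ∈ Set.Ioo (f * Rm ^ 2 / (1 + Rm * 1) +
        (1 - f) * Rr ^ 2 / (1 + Rr * 1)) (f * Rm ^ 2 / (1 + Rm * 0) +
        (1 - f) * Rr ^ 2 / (1 + Rr * 0)) := by
      constructor
      · apply add_lt_add
        · rw [div_lt_iff₀ (by positivity)]
          nlinarith [mul_pos h0 hRm]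
        · rw [div_lt_iff₀ (by positivity)]
          nlinarith [mul_pos h1 hRr]
      · simpa using h
    obtain ⟨t, ht, e⟩ := hI hm
    exact ⟨t, ht.1, (Gmap_fixed_iff Rm Rr f t hRm hRr h0 h1 ht.1).2 e⟩
  · intro s t hs0 ht0 es et
    rw [Gmap_fixed_iff Rm Rr f s hRm hRr h0 h1 hs0] at es
    rw [Gmap_fixed_iff Rm Rr f t hRm hRr h0 h1 ht0] at et
    rcases lt_trichotomy s t with h | h | h
    · have := reduced_lt Rm Rr f s t hRm hRr h0 h1 hs0.le h
      linarith
    · exact h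
    · have := reduced_lt Rm Rr f t s hRm hRr h0 h1 ht0.le h
      linarith
  · intro hle Λ hΛ h
    rcases hΛ.eq_or_lt with h2 | h2
    · exact h2.symm
    · exact absurd (only Λ h2 h) (not_lt.2 hle)
end

section
/- Fix positive reals Rm, Rr with Rm ≠ Rr, let J ⊆ (0,1) be an open interval, and let Λ : J → (0,∞) be differentiable with Λ(f) = G(Λ(f), f) for all f ∈ J. Then the function f ↦ log(Im(Λ(f))/Ir(Λ(f))) is strictly decreasing on J. -/
lemma aux_eq (p q x f : ℝ) (hp : 0 < p) (hq : 0 < q) (hx : 0 < x) (hf0 : 0 < f) (hf1 : f < 1)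
    (h : x = Gmap p q x f) :
    f * (p * (1 - p / (1 + p * x))) + (1 - f) * (q * (1 - q / (1 + q * x))) = 0 := by
  have h1 : 0 < 1 + p * x := by positivity
  have h2 : 0 < 1 + q * x := by positivity
  have hD : 0 < f * p + (1 - f) * q := by
    have : 0 < 1 - f := by linarith
    positivity
  unfold Gmap at h
  rw [eq_div_iff hD.ne'] at h
  have e1 : p * x / (1 + p * x) = x * (p / (1 + p * x)) := by ring
  have e2 : q * x / (1 + q * x) = x * (q / (1 + q * x)) := by ring
  rw [e1, e2] at h
  apply mul_left_cancel₀ hx.ne'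
  linear_combination h

lemma aux_mono (p q x y f g : ℝ) (hp : 0 < p) (hq : 0 < q) (hpq : q < p) (hx : 0 < x)
    (hy : 0 < y) (hf0 : 0 < f) (hg1 : g < 1) (hfg : f < g)
    (hf : f * (p * (1 - p / (1 + p * x))) + (1 - f) * (q * (1 - q / (1 + q * x))) = 0)
    (hg : g * (p * (1 - p / (1 + p * y))) + (1 - g) * (q * (1 - q / (1 + q * y))) = 0) :
    x < y := by
  by_contra! hle
  have mono : ∀ r : ℝ, 0 < r → r * (1 - r / (1 + r * y)) ≤ r * (1 - r / (1 + r * x)) := by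
    intro r hr
    gcongr
  have hlt : q / (1 + q * x) < p / (1 + p * x) := by
    rw [div_lt_div_iff₀ (by positivity) (by positivity)]
    nlinarith
  have m1 := mul_le_mul_of_nonneg_left (mono p hp) (by linarith : 0 ≤ g)
  have m2 := mul_le_mul_of_nonneg_left (mono q hq) (by linarith : 0 ≤ 1 - g)
  generalize p / (1 + p * x) = u at *
  generalize q / (1 + q * x) = v at *
  have hu : 1 - u < 0 := by
    by_contra! hc
    have k1 : 0 ≤ f * (p * (1 - u)) := by positivity
    have k2 : 0 < (1 - f) * (q * (1 - v)) :=
      mul_pos (by linarith) (mul_pos hq (by linarith))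
    linarith
  have hA : p * (1 - u) < 0 := mul_neg_of_pos_of_neg hp hu
  have hB : 0 < q * (1 - v) := by
    by_contra! hc
    have k1 : f * (p * (1 - u)) < 0 := mul_neg_of_pos_of_neg hf0 hA
    have k2 : (1 - f) * (q * (1 - v)) ≤ 0 :=
      mul_nonpos_of_nonneg_of_nonpos (by linarith) hc
    linarith
  have := mul_neg_of_pos_of_neg (sub_pos.2 hfg) (by linarith : p * (1 - u) - q * (1 - v) < 0)
  linarith

/-- Along a differentiable branch `Λ(f)` of positive equilibria of the
two-strategy SIS dynamics (`Λ(f) = G(Λ(f), f)` on an open interval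
`J ⊆ (0,1)`), the log-ratio `log(Im(Λ(f))/Ir(Λ(f)))` of the equilibrium
infected fractions of the two strategies is strictly decreasing in the mutant
fraction `f`. -/
theorem log_ratio_infected_strictAnti (Rm Rr : ℝ) (hRm : 0 < Rm) (hRr : 0 < Rr)
    (hne : Rm ≠ Rr) (a b : ℝ) (hJ : Set.Ioo a b ⊆ Set.Ioo (0 : ℝ) 1)
    (Λ : ℝ → ℝ)
    (hΛdiff : ∀ f ∈ Set.Ioo a b, DifferentiableAt ℝ Λ f)
    (hΛpos : ∀ f ∈ Set.Ioo a b, 0 < Λ f)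
    (hfix : ∀ f ∈ Set.Ioo a b, Λ f = Gmap Rm Rr (Λ f) f) :
    StrictAntiOn
      (fun f => Real.log ((Rm * Λ f / (1 + Rm * Λ f)) / (Rr * Λ f / (1 + Rr * Λ f))))
      (Set.Ioo a b) := by
  intro f hf g hg hfg
  have hx := hΛpos f hf
  have hy := hΛpos g hg
  obtain ⟨f0, f1⟩ := hJ hf
  obtain ⟨g0, g1⟩ := hJ hg
  have ef := aux_eq Rm Rr _ f hRm hRr hx f0 f1 (hfix f hf)
  have eg := aux_eq Rm Rr _ g hRm hRr hy g0 g1 (hfix g hg)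
  have key : 0 < (Rm - Rr) * (Λ g - Λ f) := by
    rcases lt_or_gt_of_ne hne with h | h
    · have := aux_mono Rr Rm (Λ g) (Λ f) (1 - g) (1 - f) hRr hRm h hy hx (by linarith)
        (by linarith) (by linarith) (by linarith) (by linarith)
      nlinarith
    · have := aux_mono Rm Rr (Λ f) (Λ g) f g hRm hRr h hx hy f0 g1 hfg ef eg
      nlinarith
  have ratio : ∀ x : ℝ, 0 < x → (Rm * x / (1 + Rm * x)) / (Rr * x / (1 + Rr * x)) =
      Rm / Rr * ((1 + Rr * x) / (1 + Rm * x)) := by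
    intro x hx
    have h1 : 0 < 1 + Rm * x := by positivity
    have h2 : 0 < 1 + Rr * x := by positivity
    field_simp
  simp only
  apply Real.log_lt_log (by positivity)
  rw [ratio _ hx, ratio _ hy]
  apply mul_lt_mul_of_pos_left _ (by positivity)
  rw [div_lt_div_iff₀ (by positivity) (by positivity)]
  nlinarith
end

section
/- Fix positive reals Rm, Rr with Rm ≠ Rr, let J ⊆ (0,1) be an open interval, and let Λ : J → (0,∞) be differentiable with Λ(f) = G(Λ(f), f) for all f ∈ J. Then the function f ↦ log((1 − Im(Λ(f)))/(1 − Ir(Λ(f)))), the log-ratio of the equilibrium susceptible fractions of the two strategies, is strictly decreasing on J. -/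
lemma aux_fix (R S f x : ℝ) (hR : 0 < R) (hS : 0 < S) (hf0 : 0 < f) (hf1 : f < 1) (hx : 0 < x)
    (h : x = Gmap R S x f) :
    f * (R - R ^ 2 / (1 + R * x)) + (1 - f) * (S - S ^ 2 / (1 + S * x)) = 0 := by
  have h1 : 0 < 1 + R * x := by positivity
  have h2 : 0 < 1 + S * x := by positivity
  have h3 : 0 < f * R + (1 - f) * S := by
    have := mul_pos hf0 hR
    have := mul_pos (sub_pos.2 hf1) hS
    linarith
  unfold Gmap at h
  rw [eq_div_iff h3.ne'] at h
  have e1 : R * x / (1 + R * x) = x * (R / (1 + R * x)) := by ring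
  have e2 : S * x / (1 + S * x) = x * (S / (1 + S * x)) := by ring
  rw [e1, e2] at h
  have : x * (f * (R - R ^ 2 / (1 + R * x)) + (1 - f) * (S - S ^ 2 / (1 + S * x))) = 0 := by
    linear_combination h
  exact (mul_eq_zero.1 this).resolve_left hx.ne'

lemma aux_mono_s8 (R x y : ℝ) (hR : 0 < R) (hy : 0 < y) (hyx : y ≤ x) :
    R - R ^ 2 / (1 + R * y) ≤ R - R ^ 2 / (1 + R * x) := by
  gcongr

lemma aux_lt (R S f g x y : ℝ) (hS : 0 < S) (hSR : S < R) (hf0 : 0 < f) (hfg : f < g)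
    (hg1 : g < 1) (hx : 0 < x) (hy : 0 < y)
    (h1 : f * (R - R ^ 2 / (1 + R * x)) + (1 - f) * (S - S ^ 2 / (1 + S * x)) = 0)
    (h2 : g * (R - R ^ 2 / (1 + R * y)) + (1 - g) * (S - S ^ 2 / (1 + S * y)) = 0) :
    x < y := by
  by_contra! hyx
  have hR : 0 < R := hS.trans hSR
  have m1 := aux_mono_s8 R x y hR hy hyx
  have m2 := aux_mono_s8 S x y hS hy hyx
  have p1 : 0 < 1 + R * y := by positivity
  have p2 : 0 < 1 + S * y := by positivity
  have hA : R - R ^ 2 / (1 + R * y) < 0 := by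
    by_contra! hA
    have eR : R - R ^ 2 / (1 + R * y) = R / (1 + R * y) * (1 - R * (1 - y)) := by
      field_simp; ring
    have eS : S - S ^ 2 / (1 + S * y) = S / (1 + S * y) * (1 - S * (1 - y)) := by
      field_simp; ring
    have hA' : 0 ≤ 1 - R * (1 - y) := by
      rw [eR] at hA
      exact nonneg_of_mul_nonneg_right hA (by positivity)
    have hB : 0 < 1 - S * (1 - y) := by
      rcases le_or_gt 1 y with h | h
      · nlinarith
      · nlinarith [mul_pos (sub_pos.2 hSR) (sub_pos.2 h)]
    have hB' : 0 < S - S ^ 2 / (1 + S * y) := by rw [eS]; positivity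
    have := mul_nonneg (hf0.trans hfg).le hA
    have := mul_pos (sub_pos.2 hg1) hB'
    linarith
  generalize R - R ^ 2 / (1 + R * y) = A at *
  generalize S - S ^ 2 / (1 + S * y) = B at *
  have hB : 0 < B := by
    by_contra! hB
    nlinarith [mul_pos (hf0.trans hfg) (neg_pos.2 hA),
      mul_nonneg (sub_pos.2 hg1).le (neg_nonneg.2 hB)]
  have k1 := mul_le_mul_of_nonneg_left m1 hf0.le
  have k2 := mul_le_mul_of_nonneg_left m2 (by linarith : 0 ≤ 1 - f)
  nlinarith [mul_pos (sub_pos.2 hfg) (sub_pos.2 (hA.trans hB))]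

/-- Along a differentiable branch `Λ(f)` of positive equilibria of the
two-strategy SIS dynamics (`Λ(f) = G(Λ(f), f)` on an open interval
`J ⊆ (0,1)`), the log-ratio `log((1 − Im(Λ(f)))/(1 − Ir(Λ(f))))` of the
equilibrium susceptible fractions of the two strategies is strictly
decreasing in the mutant fraction `f`. -/
theorem log_ratio_susceptible_strictAnti (Rm Rr : ℝ) (hRm : 0 < Rm) (hRr : 0 < Rr)
    (hne : Rm ≠ Rr) (a b : ℝ) (hJ : Set.Ioo a b ⊆ Set.Ioo (0 : ℝ) 1)
    (Λ : ℝ → ℝ)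
    (hΛdiff : ∀ f ∈ Set.Ioo a b, DifferentiableAt ℝ Λ f)
    (hΛpos : ∀ f ∈ Set.Ioo a b, 0 < Λ f)
    (hfix : ∀ f ∈ Set.Ioo a b, Λ f = Gmap Rm Rr (Λ f) f) :
    StrictAntiOn
      (fun f => Real.log
        ((1 - Rm * Λ f / (1 + Rm * Λ f)) / (1 - Rr * Λ f / (1 + Rr * Λ f))))
      (Set.Ioo a b) := by
  intro f hf g hg hfg
  have hx := hΛpos f hf
  have hy := hΛpos g hg
  obtain ⟨hf0, hf1⟩ := hJ hf
  obtain ⟨hg0, hg1⟩ := hJ hg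
  have h1 := aux_fix Rm Rr f _ hRm hRr hf0 hf1 hx (hfix f hf)
  have h2 := aux_fix Rm Rr g _ hRm hRr hg0 hg1 hy (hfix g hg)
  dsimp only
  generalize Λ f = x at *
  generalize Λ g = y at *
  have a1 : 0 < 1 + Rm * x := by positivity
  have a2 : 0 < 1 + Rr * x := by positivity
  have a3 : 0 < 1 + Rm * y := by positivity
  have a4 : 0 < 1 + Rr * y := by positivity
  have key : ∀ z, 0 < 1 + Rm * z → 0 < 1 + Rr * z →
      (1 - Rm * z / (1 + Rm * z)) / (1 - Rr * z / (1 + Rr * z))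
        = (1 + Rr * z) / (1 + Rm * z) := by
    intro z b1 b2
    have c1 : 1 - Rm * z / (1 + Rm * z) = 1 / (1 + Rm * z) := by
      rw [eq_div_iff b1.ne', sub_mul, div_mul_cancel₀ _ b1.ne']; ring
    have c2 : 1 - Rr * z / (1 + Rr * z) = 1 / (1 + Rr * z) := by
      rw [eq_div_iff b2.ne', sub_mul, div_mul_cancel₀ _ b2.ne']; ring
    rw [c1, c2]; field_simp
  rw [key x a1 a2, key y a3 a4]
  apply Real.log_lt_log (by positivity)
  rw [div_lt_div_iff₀ a3 a1]
  rcases lt_or_gt_of_ne hne with h | h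
  · have hyx : y < x := aux_lt Rr Rm (1 - g) (1 - f) y x hRm h (by linarith) (by linarith)
      (by linarith) hy hx (by linear_combination h2) (by linear_combination h1)
    nlinarith [mul_pos (sub_pos.2 h) (sub_pos.2 hyx)]
  · have hxy : x < y := aux_lt Rm Rr f g x y hRr h hf0 hfg hg1 hx hy h1 h2
    nlinarith [mul_pos (sub_pos.2 h) (sub_pos.2 hxy)]
end

section
/- (Proposition 1, monotonicity part.) Let α ∈ (0,1), c > 0, and Rm, Rr ≥ 1 with Rm ≠ Rr and max(Rm, Rr) > 1. Let Λg : (0,1) → (0,∞) be differentiable with Λg(f) = G_{Rm,Rr}(Λg(f), f) for all f ∈ (0,1), and let Λb : (0,1) → [0,∞) be either identically 0 or differentiable, positive, and satisfying Λb(f) = G_{c·Rm, c·Rr}(Λb(f), f) for all f ∈ (0,1). Define the equilibrium infected fractions Img(f) = Rm·Λg(f)/(1 + Rm·Λg(f)), Irg(f) = Rr·Λg(f)/(1 + Rr·Λg(f)), Imb(f) = c·Rm·Λb(f)/(1 + c·Rm·Λb(f)), Irb(f) = c·Rr·Λb(f)/(1 + c·Rr·Λb(f)), and the Cobb-Douglas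 utilities Um(f) = (Img(f))^α·(1 − Imb(f))^(1−α) and Ur(f) = (Irg(f))^α·(1 − Irb(f))^(1−α). Then f ↦ log Um(f) − log Ur(f) is strictly decreasing on (0,1). -/
/-- The equilibrium map of the two-strategy SIS contagion dynamics for a
contagion with mutant reproduction number `A` and resident reproduction
number `B`. -/
noncomputable def Gfun (A B Λ f : ℝ) : ℝ :=
  (f * A * (A * Λ / (1 + A * Λ)) + (1 - f) * B * (B * Λ / (1 + B * Λ))) /
    (f * A + (1 - f) * B)

lemma fix_eq (A B L f : ℝ) (hA : 0 < A) (hB : 0 < B) (hL : 0 < L) (hf : f ∈ Set.Ioo (0:ℝ) 1)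
    (h : L = Gfun A B L f) :
    f * (A * (1 - A / (1 + A * L))) + (1 - f) * (B * (1 - B / (1 + B * L))) = 0 := by
  obtain ⟨h0, h1⟩ := hf
  have h1' : 0 < 1 - f := by linarith
  have hD : 0 < f * A + (1 - f) * B := by positivity
  unfold Gfun at h
  rw [eq_div_iff hD.ne'] at h
  have e : L * (f * (A * (1 - A / (1 + A * L))) + (1 - f) * (B * (1 - B / (1 + B * L)))) = 0 := by
    have : L * (f * (A * (1 - A / (1 + A * L))) + (1 - f) * (B * (1 - B / (1 + B * L)))) =
      L * (f * A + (1 - f) * B) - (f * A * (A * L / (1 + A * L)) +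
        (1 - f) * B * (B * L / (1 + B * L))) := by ring
    rw [this]; linarith
  exact (mul_eq_zero.mp e).resolve_left hL.ne'

lemma phi_mono (A L1 L2 : ℝ) (hA : 0 < A) (h1 : 0 < L1) (h : L1 ≤ L2) :
    A * (1 - A / (1 + A * L1)) ≤ A * (1 - A / (1 + A * L2)) := by
  have : 0 < 1 + A * L1 := by positivity
  gcongr

lemma mono_aux (A B L1 L2 f1 f2 : ℝ) (hA : 0 < A) (hB : 0 < B) (hAB : B < A)
    (hL1 : 0 < L1) (hL2 : 0 < L2) (h1 : 0 < f1) (h12 : f1 < f2) (h2 : f2 < 1)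
    (e1 : f1 * (A * (1 - A / (1 + A * L1))) + (1 - f1) * (B * (1 - B / (1 + B * L1))) = 0)
    (e2 : f2 * (A * (1 - A / (1 + A * L2))) + (1 - f2) * (B * (1 - B / (1 + B * L2))) = 0) :
    L1 < L2 := by
  by_contra! hcon
  have mA := phi_mono A L2 L1 hA hL2 hcon
  have mB := phi_mono B L2 L1 hB hL2 hcon
  have hq : B / (1 + B * L1) < A / (1 + A * L1) := by
    rw [div_lt_div_iff₀ (by positivity) (by positivity)]; nlinarith
  have hqB : B / (1 + B * L1) < 1 := by
    by_contra! hx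
    have a1 : A * (1 - A / (1 + A * L1)) < 0 := mul_neg_of_pos_of_neg hA (by linarith)
    have a2 : B * (1 - B / (1 + B * L1)) ≤ 0 :=
      mul_nonpos_of_nonneg_of_nonpos hB.le (by linarith)
    nlinarith
  have pB : 0 < B * (1 - B / (1 + B * L1)) := mul_pos hB (by linarith)
  generalize A * (1 - A / (1 + A * L1)) = x1 at *
  generalize A * (1 - A / (1 + A * L2)) = x2 at *
  generalize B * (1 - B / (1 + B * L1)) = y1 at *
  generalize B * (1 - B / (1 + B * L2)) = y2 at *
  have nA : x1 < 0 := by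
    by_contra! hx
    nlinarith [mul_nonneg h1.le hx, mul_pos (show 0 < 1 - f1 by linarith) pB]
  have k1 : f2 * x2 ≤ f2 * x1 := mul_le_mul_of_nonneg_left mA (by linarith)
  have k2 : (1 - f2) * y2 ≤ (1 - f2) * y1 := mul_le_mul_of_nonneg_left mB (by linarith)
  nlinarith [mul_pos (sub_pos.2 h12) (show 0 < y1 - x1 by linarith)]

lemma ratio_anti (A B : ℝ) (hA : 0 < A) (hB : 0 < B) (hne : A ≠ B) (L : ℝ → ℝ)
    (hpos : ∀ f ∈ Set.Ioo (0 : ℝ) 1, 0 < L f)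
    (hfix : ∀ f ∈ Set.Ioo (0 : ℝ) 1, L f = Gfun A B (L f) f) :
    StrictAntiOn (fun f => Real.log (1 + B * L f) - Real.log (1 + A * L f))
      (Set.Ioo (0 : ℝ) 1) := by
  intro f1 hf1 f2 hf2 h12
  have p1 := hpos f1 hf1
  have p2 := hpos f2 hf2
  have e1 := fix_eq A B _ f1 hA hB p1 hf1 (hfix f1 hf1)
  have e2 := fix_eq A B _ f2 hA hB p2 hf2 (hfix f2 hf2)
  have key : 0 < (A - B) * (L f2 - L f1) := by
    rcases lt_or_gt_of_ne hne with h | h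
    · have := mono_aux B A (L f2) (L f1) (1 - f2) (1 - f1) hB hA h p2 p1 (by linarith [hf2.2])
        (by linarith) (by linarith [hf1.1]) (by linarith) (by linarith)
      exact mul_pos_of_neg_of_neg (by linarith) (by linarith)
    · have := mono_aux A B (L f1) (L f2) f1 f2 hA hB h p1 p2 hf1.1 h12 hf2.2 e1 e2
      exact mul_pos (by linarith) (by linarith)
  have l : Real.log ((1 + B * L f2) * (1 + A * L f1)) <
      Real.log ((1 + B * L f1) * (1 + A * L f2)) :=
    Real.log_lt_log (by positivity) (by nlinarith)
  rw [Real.log_mul (by positivity) (by positivity),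
    Real.log_mul (by positivity) (by positivity)] at l
  show Real.log (1 + B * L f2) - Real.log (1 + A * L f2) <
    Real.log (1 + B * L f1) - Real.log (1 + A * L f1)
  linarith

lemma log_util (α R S x y : ℝ) (hR : 0 < R) (hS : 0 < S) (hx : 0 < x) (hy : 0 ≤ y) :
    Real.log ((R * x / (1 + R * x)) ^ α * (1 - S * y / (1 + S * y)) ^ (1 - α)) =
      α * (Real.log R + Real.log x - Real.log (1 + R * x))
        - (1 - α) * Real.log (1 + S * y) := by
  have h1 : 0 < 1 + S * y := by positivity
  have e : 1 - S * y / (1 + S * y) = (1 + S * y)⁻¹ := by field_simp; ring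
  rw [e, Real.log_mul (by positivity) (by positivity), Real.log_rpow (by positivity),
    Real.log_rpow (by positivity), Real.log_div (by positivity) (by positivity),
    Real.log_mul hR.ne' hx.ne', Real.log_inv]
  ring

/-- Proposition 1, monotonicity part: along differentiable equilibrium
branches `Λg` (good contagion, reproduction numbers `Rm, Rr`) and `Λb` (bad
contagion, reproduction numbers `c·Rm, c·Rr`; either identically zero or a
positive equilibrium branch), the difference of the Cobb-Douglas log-utilities
of the mutant and resident strategies is strictly decreasing in the mutant
fraction `f ∈ (0,1)`. -/
theorem cobbDouglas_logUtility_difference_strictAnti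
    (α c Rm Rr : ℝ) (hα : α ∈ Set.Ioo (0 : ℝ) 1) (hc : 0 < c)
    (hRm : 1 ≤ Rm) (hRr : 1 ≤ Rr) (hne : Rm ≠ Rr) (hmax : 1 < max Rm Rr)
    (Λg Λb : ℝ → ℝ)
    (hΛgdiff : ∀ f ∈ Set.Ioo (0 : ℝ) 1, DifferentiableAt ℝ Λg f)
    (hΛgpos : ∀ f ∈ Set.Ioo (0 : ℝ) 1, 0 < Λg f)
    (hΛgfix : ∀ f ∈ Set.Ioo (0 : ℝ) 1, Λg f = Gfun Rm Rr (Λg f) f)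
    (hΛb : (∀ f ∈ Set.Ioo (0 : ℝ) 1, Λb f = 0) ∨
      ((∀ f ∈ Set.Ioo (0 : ℝ) 1, DifferentiableAt ℝ Λb f) ∧
       (∀ f ∈ Set.Ioo (0 : ℝ) 1, 0 < Λb f) ∧
       (∀ f ∈ Set.Ioo (0 : ℝ) 1, Λb f = Gfun (c * Rm) (c * Rr) (Λb f) f))) :
    StrictAntiOn
      (fun f =>
        Real.log ((Rm * Λg f / (1 + Rm * Λg f)) ^ α *
          (1 - c * Rm * Λb f / (1 + c * Rm * Λb f)) ^ (1 - α)) -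
        Real.log ((Rr * Λg f / (1 + Rr * Λg f)) ^ α *
          (1 - c * Rr * Λb f / (1 + c * Rr * Λb f)) ^ (1 - α)))
      (Set.Ioo (0 : ℝ) 1) := by
  have pm : 0 < Rm := by linarith
  have pr : 0 < Rr := by linarith
  have g := ratio_anti Rm Rr pm pr hne Λg hΛgpos hΛgfix
  have hb0 : ∀ f ∈ Set.Ioo (0 : ℝ) 1, 0 ≤ Λb f := by
    rcases hΛb with h | ⟨-, h, -⟩
    · exact fun f hf => (h f hf).ge
    · exact fun f hf => (h f hf).le
  have b : AntitoneOn (fun f => Real.log (1 + c * Rr * Λb f) - Real.log (1 + c * Rm * Λb f))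
      (Set.Ioo (0 : ℝ) 1) := by
    rcases hΛb with h | ⟨-, h, h'⟩
    · intro f1 hf1 f2 hf2 _
      simp [h f1 hf1, h f2 hf2]
    · exact (ratio_anti (c * Rm) (c * Rr) (by positivity) (by positivity)
        (fun h => hne (mul_left_cancel₀ hc.ne' h)) Λb h h').antitoneOn
  intro f1 hf1 f2 hf2 h12
  have g' := mul_lt_mul_of_pos_left (g hf1 hf2 h12) hα.1
  have b' := mul_le_mul_of_nonneg_left (b hf1 hf2 h12.le) (sub_nonneg.2 hα.2.le)
  have cm : 0 < c * Rm := by positivity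
  have cr : 0 < c * Rr := by positivity
  beta_reduce at g' b' ⊢
  rw [log_util α Rm (c * Rm) _ _ pm cm (hΛgpos f1 hf1) (hb0 f1 hf1),
    log_util α Rm (c * Rm) _ _ pm cm (hΛgpos f2 hf2) (hb0 f2 hf2),
    log_util α Rr (c * Rr) _ _ pr cr (hΛgpos f1 hf1) (hb0 f1 hf1),
    log_util α Rr (c * Rr) _ _ pr cr (hΛgpos f2 hf2) (hb0 f2 hf2)]
  linarith
end

section
/- Fix α ∈ (0,1), c > 0, and a resident reproduction number Rr > 1. Define s : (0,∞) → ℝ by s(Rm) = α·log Îg(Rm, Rr) + (1−α)·log Ŝb(Rm, Rr). Then s is differentiable at Rm = Rr, and its derivative there (the local selection gradient) equals α/Rr² if c·Rr ≤ 1, and equals (1/Rr²)·(α − (1−α)·(Rr − 1/c)) if c·Rr > 1. -/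
/-- The local selection gradient of the mutant log-utility under Cobb-Douglas
utility: for a resident at reproduction number `Rr > 1`, the mutant log-utility
`s(Rm) = α·log Îg(Rm,Rr) + (1−α)·log Ŝb(Rm,Rr)` is differentiable at
`Rm = Rr` with derivative `α/Rr²` if `c·Rr ≤ 1` and
`(1/Rr²)·(α − (1−α)·(Rr − 1/c))` if `c·Rr > 1`. -/
theorem local_selection_gradient_cobbDouglas (α c Rr : ℝ)
    (hα : α ∈ Set.Ioo (0 : ℝ) 1) (hc : 0 < c) (hRr : 1 < Rr) :
    let Ig : ℝ → ℝ := fun Rm => Rm * (Rr - 1) / (Rm * (Rr - 1) + Rr)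
    let Sb : ℝ → ℝ := fun Rm =>
      if c * Rr ≤ 1 then 1 else Rr / (Rm * (c * Rr - 1) + Rr)
    let s : ℝ → ℝ := fun Rm => α * Real.log (Ig Rm) + (1 - α) * Real.log (Sb Rm)
    (c * Rr ≤ 1 → HasDerivAt s (α / Rr ^ 2) Rr) ∧
    (1 < c * Rr →
      HasDerivAt s ((1 / Rr ^ 2) * (α - (1 - α) * (Rr - 1 / c))) Rr) := by
  intro Ig Sb s
  have hR : 0 < Rr := by linarith
  have hR1 : 0 < Rr - 1 := by linarith
  have hlin : ∀ k : ℝ, HasDerivAt (fun Rm : ℝ => Rm * k) k Rr := fun k => by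
    simpa using (hasDerivAt_id Rr).mul_const k
  have hD : Rr * (Rr - 1) + Rr = Rr ^ 2 := by ring
  have hIg : HasDerivAt (fun Rm => Real.log (Ig Rm)) (1 / Rr ^ 2) Rr := by
    have h1 : HasDerivAt Ig _ Rr :=
      (hlin (Rr - 1)).div ((hlin (Rr - 1)).add_const Rr) (by rw [hD]; positivity)
    have h2 := h1.log (by
      change Rr * (Rr - 1) / (Rr * (Rr - 1) + Rr) ≠ 0
      positivity)
    refine h2.congr_deriv ?_
    change _ / (Rr * (Rr - 1) / (Rr * (Rr - 1) + Rr)) = _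
    rw [hD]
    field_simp
    ring
  constructor
  · intro h
    have hs : s = fun Rm => α * Real.log (Ig Rm) := by
      funext Rm
      simp [s, Sb, h]
    rw [hs]
    exact (hIg.const_mul α).congr_deriv (by ring)
  · intro h
    have hk : 0 < c * Rr - 1 := by linarith
    have hE : Rr * (c * Rr - 1) + Rr = c * Rr ^ 2 := by ring
    have hSbe : Sb = fun Rm => Rr / (Rm * (c * Rr - 1) + Rr) := by
      funext Rm
      simp only [Sb, if_neg (not_le.mpr h)]
    have hSb : HasDerivAt (fun Rm => Real.log (Sb Rm))
        (-(Rr - 1 / c) / Rr ^ 2) Rr := by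
      rw [hSbe]
      have h1 := (hasDerivAt_const Rr Rr).div ((hlin (c * Rr - 1)).add_const Rr)
        (by rw [hE]; positivity)
      have h2 := h1.log (by
        change Rr / (Rr * (c * Rr - 1) + Rr) ≠ 0
        positivity)
      refine h2.congr_deriv ?_
      change _ / (Rr / (Rr * (c * Rr - 1) + Rr)) = _
      rw [hE]
      field_simp
      ring
    exact ((hIg.const_mul α).add (hSb.const_mul (1 - α))).congr_deriv (by ring)
end

section
/- Fix α ∈ (0,1) and c > 0, define g : (1,∞) → ℝ by g(R) = α/R² if R ≤ 1/c and g(R) = (1/R²)·(α − (1−α)·(R − 1/c)) if R > 1/c, and set R* = 1/c + α/(1−α). If R* > 1, then g(R) > 0 for all 1 < R < R*, g(R*) = 0, and g(R) < 0 for all R > R*; in particular R* is the unique zero of g on (1,∞). If instead α < 1/2 and c > (1−α)/(1−2α), then g(R) < 0 for all R > 1. Consequently the evolutionarily stable sociality level is R_ESS = max(1, 1/c + α/(1−α)). -/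
/-- Signs of the local selection gradient
`g(R) = α/R²` for `R ≤ 1/c`, `g(R) = (1/R²)·(α − (1−α)·(R − 1/c))` for
`R > 1/c`, on the domain `R > 1`: if the singular strategy
`R* = 1/c + α/(1−α)` is feasible (`R* > 1`) it is the unique zero of `g` on
`(1,∞)`, with `g > 0` below it and `g < 0` above it; if `α < 1/2` and
`c > (1−α)/(1−2α)` then `g < 0` on all of `(1,∞)`.  Consequently the
evolutionarily stable sociality level is `R_ESS = max(1, 1/c + α/(1−α))`:
`g > 0` on `(1, R_ESS)` and `g < 0` on `(R_ESS, ∞)`. -/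
theorem selection_gradient_signs_and_ESS (α c : ℝ)
    (hα : α ∈ Set.Ioo (0 : ℝ) 1) (hc : 0 < c) :
    let g : ℝ → ℝ := fun R =>
      if R ≤ 1 / c then α / R ^ 2 else (1 / R ^ 2) * (α - (1 - α) * (R - 1 / c))
    let Rstar : ℝ := 1 / c + α / (1 - α)
    (1 < Rstar →
      (∀ R : ℝ, 1 < R → R < Rstar → 0 < g R) ∧ g Rstar = 0 ∧
      (∀ R : ℝ, Rstar < R → g R < 0) ∧
      (∀ R : ℝ, 1 < R → g R = 0 → R = Rstar)) ∧
    (α < 1 / 2 → (1 - α) / (1 - 2 * α) < c → ∀ R : ℝ, 1 < R → g R < 0) ∧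
    (∀ R : ℝ, max 1 Rstar < R → g R < 0) ∧
    (∀ R : ℝ, 1 < R → R < max 1 Rstar → 0 < g R) := by
  intro g Rstar
  obtain ⟨h0, h1⟩ := hα
  have h1' : 0 < 1 - α := by linarith
  have hi : 0 < 1 / c := by positivity
  have hk : 0 < α / (1 - α) := by positivity
  have hkα : (1 - α) * (α / (1 - α)) = α := by field_simp
  have hRs : Rstar = 1 / c + α / (1 - α) := rfl
  have hform : ∀ R : ℝ, α - (1 - α) * (R - 1 / c) = (1 - α) * (Rstar - R) := by
    intro R
    rw [hRs]
    linear_combination (-1 : ℝ) * hkα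
  have hpos : ∀ R : ℝ, 1 < R → R < Rstar → 0 < g R := by
    intro R hR hlt
    have hR0 : 0 < R := by linarith
    simp only [g]
    split_ifs with h
    · positivity
    · rw [hform]
      have : 0 < Rstar - R := by linarith
      positivity
  have hneg : ∀ R : ℝ, Rstar < R → g R < 0 := by
    intro R hlt
    have hR0 : 0 < R := by linarith
    have h : ¬ R ≤ 1 / c := by
      intro h
      linarith
    simp only [g]
    rw [if_neg h, hform]
    have h2 : 0 < 1 / R ^ 2 := by positivity
    exact mul_neg_of_pos_of_neg h2 (mul_neg_of_pos_of_neg h1' (by linarith))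
  have hzero : g Rstar = 0 := by
    have h : ¬ Rstar ≤ 1 / c := by
      intro h
      linarith
    simp only [g]
    rw [if_neg h, hform]
    ring
  refine ⟨fun _ => ⟨hpos, hzero, hneg, ?_⟩, ?_, ?_, ?_⟩
  · intro R hR hg
    rcases lt_trichotomy R Rstar with h | h | h
    · exact absurd hg (hpos R hR h).ne'
    · exact h
    · exact absurd hg (hneg R h).ne
  · intro ha hcc R hR
    apply hneg
    have h2 : 0 < 1 - 2 * α := by linarith
    have h3 : 1 / c < 1 / ((1 - α) / (1 - 2 * α)) :=
      one_div_lt_one_div_of_lt (by positivity) hcc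
    have h4 : 1 / ((1 - α) / (1 - 2 * α)) = 1 - α / (1 - α) := by
      field_simp
      ring
    linarith
  · intro R hR
    exact hneg R (lt_of_le_of_lt (le_max_right _ _) hR)
  · intro R hR hlt
    rcases lt_max_iff.mp hlt with h | h
    · linarith
    · exact hpos R hR h
end

section
/- Let α ∈ (0,1) and c > 0, and set R_ESS = max(1, 1/c + α/(1−α)) and R_opt = max(1/c, 1/(1−α)). Then R_ESS > R_opt if c < 1, R_ESS = R_opt if c = 1, and R_ESS < R_opt if c > 1. -/
/-- The social dilemma of sociality under Cobb-Douglas utility: comparing the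
evolutionarily stable reproduction number `R_ESS = max(1, 1/c + α/(1−α))` with
the socially optimal one `R_opt = max(1/c, 1/(1−α))`: `R_ESS > R_opt` when
`c < 1`, `R_ESS = R_opt` when `c = 1`, and `R_ESS < R_opt` when `c > 1`. -/
theorem ESS_vs_social_optimum (α c : ℝ) (hα : α ∈ Set.Ioo (0 : ℝ) 1)
    (hc : 0 < c) :
    (c < 1 →
      max (1 / c) (1 / (1 - α)) < max 1 (1 / c + α / (1 - α))) ∧
    (c = 1 →
      max 1 (1 / c + α / (1 - α)) = max (1 / c) (1 / (1 - α))) ∧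
    (1 < c →
      max 1 (1 / c + α / (1 - α)) < max (1 / c) (1 / (1 - α))) := by
  obtain ⟨h0, h1⟩ := hα
  have hpos : 0 < 1 - α := by linarith
  have ht : 0 < α / (1 - α) := div_pos h0 hpos
  have he : 1 / (1 - α) = 1 + α / (1 - α) := by
    have hne : 1 - α ≠ 0 := hpos.ne'
    field_simp
    ring
  rw [he]
  generalize α / (1 - α) = t at ht
  refine ⟨fun h => ?_, fun h => ?_, fun h => ?_⟩
  · have h2 : 1 < 1 / c := (one_lt_div hc).mpr h
    exact lt_max_of_lt_right (max_lt (by linarith) (by linarith))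
  · subst h
    rw [div_one]
  · have h2 : 1 / c < 1 := (div_lt_one hc).mpr h
    exact lt_max_of_lt_right (max_lt (by linarith) (by linarith))
end

section
/- Fix c > 0 and R > max(1, 1/c), and let U : ℝ² → ℝ be continuously differentiable with partial derivatives ∂₁U and ∂₂U. Define F(Rm) = U(Îg(Rm, R), Ŝb(Rm, R)) for Rm > 0, and V(ρ) = U(1 − 1/ρ, 1/(c·ρ)) for ρ > max(1, 1/c). Then F′(R) = ((R − 1)/R)·V′(R) + (1/(c·R³))·(1/c − 1)·∂₂U(1 − 1/R, 1/(c·R)). -/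
/-- The selection-gradient identity: for a resident at `R > max(1, 1/c)` and
a continuously differentiable utility `U(I, S)`, the local selection gradient
`F'(R)` (where `F(Rm) = U(Îg(Rm,R), Ŝb(Rm,R))` is the rare-mutant utility)
relates to the derivative of the monomorphic utility `V(ρ) = U(1 − 1/ρ, 1/(c·ρ))`
via `F'(R) = ((R − 1)/R)·V'(R) + (1/(c·R³))·(1/c − 1)·∂₂U(1 − 1/R, 1/(c·R))`. -/
theorem selection_gradient_identity (c R : ℝ) (hc : 0 < c)
    (hR : max 1 (1 / c) < R) (U : ℝ × ℝ → ℝ) (hU : ContDiff ℝ 1 U) :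
    deriv (fun Rm : ℝ =>
        U (Rm * (R - 1) / (Rm * (R - 1) + R), R / (Rm * (c * R - 1) + R))) R =
      ((R - 1) / R) * deriv (fun ρ : ℝ => U (1 - 1 / ρ, 1 / (c * ρ))) R +
        (1 / (c * R ^ 3)) * (1 / c - 1) *
          fderiv ℝ U (1 - 1 / R, 1 / (c * R)) ((0, 1) : ℝ × ℝ) := by
  have hR1 : 1 < R := lt_of_le_of_lt (le_max_left _ _) hR
  have hR0 : R ≠ 0 := by positivity
  have hc0 : c ≠ 0 := hc.ne'
  have hd1 : R * (R - 1) + R = R ^ 2 := by ring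
  have hd2 : R * (c * R - 1) + R = c * R ^ 2 := by ring
  have hn1 : R * (R - 1) + R ≠ 0 := by rw [hd1]; positivity
  have hn2 : R * (c * R - 1) + R ≠ 0 := by rw [hd2]; positivity
  have key : ∀ (f g : ℝ → ℝ) (f' g' : ℝ), HasDerivAt f f' R → HasDerivAt g g' R →
      f R = 1 - 1 / R → g R = 1 / (c * R) →
      deriv (fun x => U (f x, g x)) R =
        f' * fderiv ℝ U (1 - 1 / R, 1 / (c * R)) ((1, 0) : ℝ × ℝ) +
        g' * fderiv ℝ U (1 - 1 / R, 1 / (c * R)) ((0, 1) : ℝ × ℝ) := by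
    intro f g f' g' hf hg hfR hgR
    have hD : HasFDerivAt U (fderiv ℝ U (f R, g R)) (f R, g R) :=
      ((hU.differentiable one_ne_zero) _).hasFDerivAt
    have h := hD.comp_hasDerivAt R (hf.prodMk hg)
    have h2 := h.deriv
    rw [hfR, hgR] at h2
    have e : ((f', g') : ℝ × ℝ) = f' • ((1, 0) : ℝ × ℝ) + g' • ((0, 1) : ℝ × ℝ) := by
      simp
    rw [e, map_add, map_smul, map_smul, smul_eq_mul, smul_eq_mul] at h2
    exact h2
  have hi : HasDerivAt (fun x : ℝ => x) 1 R := hasDerivAt_id R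
  have a1 : HasDerivAt (fun x : ℝ => x * (R - 1) / (x * (R - 1) + R)) ((R - 1) / R ^ 3) R := by
    refine ((hi.mul_const (R - 1)).div ((hi.mul_const (R - 1)).add_const R) hn1).congr_deriv ?_
    rw [hd1]; field_simp; ring
  have a2 : HasDerivAt (fun x : ℝ => R / (x * (c * R - 1) + R))
      (-(c * R - 1) / (c ^ 2 * R ^ 3)) R := by
    refine ((hasDerivAt_const R R).div
      ((hi.mul_const (c * R - 1)).add_const R) hn2).congr_deriv ?_
    rw [hd2]; field_simp; ring
  have b1 : HasDerivAt (fun x : ℝ => 1 - 1 / x) (1 / R ^ 2) R := by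
    refine (((hasDerivAt_const R (1 : ℝ)).div hi hR0).const_sub 1).congr_deriv ?_
    field_simp; ring
  have b2 : HasDerivAt (fun x : ℝ => 1 / (c * x)) (-1 / (c * R ^ 2)) R := by
    refine ((hasDerivAt_const R (1 : ℝ)).div (hi.const_mul c)
      (mul_ne_zero hc0 hR0)).congr_deriv ?_
    field_simp; ring
  rw [key _ _ _ _ a1 a2 (by rw [hd1]; field_simp) (by rw [hd2]; field_simp),
    key _ _ _ _ b1 b2 rfl rfl]
  field_simp
  ring
end

section
/- Fix c > 0 with c ≠ 1, R > max(1, 1/c), and a continuously differentiable U : ℝ² → ℝ with ∂₂U(1 − 1/R, 1/(c·R)) > 0, and define F and V as in the selection-gradient identity. If c < 1 and V′(R) ≥ 0, then F′(R) > 0; if c > 1 and V′(R) ≤ 0, then F′(R) < 0. In particular, if V′(R) = 0 (R is an interior critical point of the monomorphic utility), then F′(R) ≠ 0, so no interior social optimum is an evolutionarily singular strategy when c ≠ 1. -/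
/-- The social dilemma for general utilities: with `c ≠ 1`, a resident level
`R > max(1, 1/c)`, and a continuously differentiable utility `U` with
`∂₂U > 0` at the resident equilibrium, the local selection gradient `F'(R)`
and the monomorphic utility derivative `V'(R)` satisfy: if `c < 1` and
`V'(R) ≥ 0` then `F'(R) > 0`; if `c > 1` and `V'(R) ≤ 0` then `F'(R) < 0`;
in particular an interior critical point of `V` is never an evolutionarily
singular strategy. -/
theorem no_interior_social_optimum_is_singular (c R : ℝ) (hc : 0 < c)
    (hc1 : c ≠ 1) (hR : max 1 (1 / c) < R) (U : ℝ × ℝ → ℝ)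
    (hU : ContDiff ℝ 1 U)
    (hU2 : 0 < fderiv ℝ U (1 - 1 / R, 1 / (c * R)) ((0, 1) : ℝ × ℝ)) :
    let F : ℝ → ℝ := fun Rm =>
      U (Rm * (R - 1) / (Rm * (R - 1) + R), R / (Rm * (c * R - 1) + R))
    let V : ℝ → ℝ := fun ρ => U (1 - 1 / ρ, 1 / (c * ρ))
    (c < 1 → 0 ≤ deriv V R → 0 < deriv F R) ∧
    (1 < c → deriv V R ≤ 0 → deriv F R < 0) ∧
    (deriv V R = 0 → deriv F R ≠ 0) := by
  intro F V
  have h1 : 1 < R := lt_of_le_of_lt (le_max_left _ _) hR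
  have hR0 : 0 < R := by linarith
  have hRn : R ≠ 0 := hR0.ne'
  have hcn : c ≠ 0 := hc.ne'
  have e1 : R * (R - 1) + R = R ^ 2 := by ring
  have e2 : R * (c * R - 1) + R = c * R ^ 2 := by ring
  have n1 : R * (R - 1) + R ≠ 0 := by rw [e1]; positivity
  have n2 : R * (c * R - 1) + R ≠ 0 := by rw [e2]; positivity
  have n3 : c * R ≠ 0 := by positivity
  set p : ℝ × ℝ := (1 - 1 / R, 1 / (c * R)) with hp
  set L := fderiv ℝ U p with hL
  have hUd : HasFDerivAt U L p :=
    ((hU.differentiable (by norm_num)) p).hasFDerivAt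
  have hlin : ∀ x y : ℝ, L (x, y) = x * L (1, 0) + y * L (0, 1) := by
    intro x y
    have : ((x, y) : ℝ × ℝ) = x • ((1, 0) : ℝ × ℝ) + y • ((0, 1) : ℝ × ℝ) := by
      simp
    rw [this, map_add, map_smul, map_smul, smul_eq_mul, smul_eq_mul]
  have hid := hasDerivAt_id' R
  -- derivative of the monomorphic utility
  have hV1 : HasDerivAt (fun ρ : ℝ => 1 - 1 / ρ) (1 / R ^ 2) R := by
    have := ((hasDerivAt_const R (1 : ℝ)).fun_div hid hRn).const_sub 1
    refine this.congr_deriv ?_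
    field_simp
    ring
  have hV2 : HasDerivAt (fun ρ : ℝ => 1 / (c * ρ)) (-(1 / (c * R ^ 2))) R := by
    have := (hasDerivAt_const R (1 : ℝ)).fun_div (hid.const_mul c) n3
    refine this.congr_deriv ?_
    field_simp
    ring
  have hV : deriv V R = 1 / R ^ 2 * L (1, 0) + -(1 / (c * R ^ 2)) * L (0, 1) := by
    rw [← hlin]
    exact (hUd.comp_hasDerivAt R (hV1.prodMk hV2)).deriv
  -- selection gradient
  have hF1 : HasDerivAt (fun x : ℝ => x * (R - 1) / (x * (R - 1) + R))
      ((R - 1) / R ^ 3) R := by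
    have := (hid.mul_const (R - 1)).fun_div ((hid.mul_const (R - 1)).add_const R) n1
    refine this.congr_deriv ?_
    rw [e1]
    field_simp
    ring
  have hF2 : HasDerivAt (fun x : ℝ => R / (x * (c * R - 1) + R))
      (-((c * R - 1) / (c ^ 2 * R ^ 3))) R := by
    have := (hasDerivAt_const R R).fun_div ((hid.mul_const (c * R - 1)).add_const R) n2
    refine this.congr_deriv ?_
    rw [e2]
    field_simp
    ring
  have hpF : (R * (R - 1) / (R * (R - 1) + R), R / (R * (c * R - 1) + R)) = p := by
    rw [e1, e2, hp]
    ext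
    · simp only
      field_simp
    · simp only
      field_simp
  have hF : deriv F R = (R - 1) / R ^ 3 * L (1, 0)
      + -((c * R - 1) / (c ^ 2 * R ^ 3)) * L (0, 1) := by
    rw [← hlin]
    rw [← hpF] at hUd
    exact (hUd.comp_hasDerivAt R (hF1.prodMk hF2)).deriv
  have key : deriv F R = (R - 1) / R * deriv V R
      + (1 - c) * (L (0, 1) / (c ^ 2 * R ^ 3)) := by
    rw [hF, hV]
    field_simp
    ring
  have hk : 0 < (R - 1) / R := div_pos (by linarith) hR0
  have hb : 0 < L (0, 1) / (c ^ 2 * R ^ 3) := div_pos hU2 (by positivity)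
  have A : c < 1 → 0 ≤ deriv V R → 0 < deriv F R := by
    intro h hv
    rw [key]
    have := mul_nonneg hk.le hv
    have := mul_pos (sub_pos.2 h) hb
    linarith
  have B : 1 < c → deriv V R ≤ 0 → deriv F R < 0 := by
    intro h hv
    rw [key]
    have := mul_nonpos_of_nonneg_of_nonpos hk.le hv
    have := mul_neg_of_neg_of_pos (sub_neg.2 h) hb
    linarith
  refine ⟨A, B, fun hv => ?_⟩
  rcases lt_or_gt_of_ne hc1 with h | h
  · exact (A h hv.ge).ne'
  · exact (B h hv.le).ne
end

section
/- Fix c ∈ (0,1) and a continuously differentiable U : ℝ² → ℝ, and for R > 1/c let s(R) = F_R′(R) denote the local selection gradient, where F_R(Rm) = U(Îg(Rm, R), Ŝb(Rm, R)). Then the limit of s(R) as R → (1/c)⁺ equals c²·(1 − c)·∂₁U(1 − c, 1); in particular, this limit is strictly positive whenever ∂₁U(1 − c, 1) > 0, so the bad-contagion-free strategy R = 1/c is not evolutionarily stable when c < 1. -/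
/-- For `c ∈ (0,1)`, the local selection gradient
`s(R) = (d/dRm) U(Îg(Rm,R), Ŝb(Rm,R)) |_{Rm = R}` tends, as `R → (1/c)⁺`, to
`c²·(1 − c)·∂₁U(1 − c, 1)`, which is strictly positive whenever
`∂₁U(1 − c, 1) > 0`; hence the bad-contagion-free strategy `R = 1/c` is not
evolutionarily stable when `c < 1`. -/
theorem selection_gradient_limit_at_bad_free (c : ℝ)
    (hc : c ∈ Set.Ioo (0 : ℝ) 1) (U : ℝ × ℝ → ℝ) (hU : ContDiff ℝ 1 U) :
    let s : ℝ → ℝ := fun R =>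
      deriv (fun Rm : ℝ =>
        U (Rm * (R - 1) / (Rm * (R - 1) + R), R / (Rm * (c * R - 1) + R))) R
    Filter.Tendsto s (nhdsWithin (1 / c) (Set.Ioi (1 / c)))
        (nhds (c ^ 2 * (1 - c) * fderiv ℝ U (1 - c, 1) ((1, 0) : ℝ × ℝ))) ∧
      (0 < fderiv ℝ U (1 - c, 1) ((1, 0) : ℝ × ℝ) →
        0 < c ^ 2 * (1 - c) * fderiv ℝ U (1 - c, 1) ((1, 0) : ℝ × ℝ)) := by
  obtain ⟨h0, h1⟩ := hc
  intro s
  refine ⟨?_, fun h => mul_pos (mul_pos (pow_pos h0 2) (by linarith)) h⟩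
  have hc0 : c ≠ 0 := h0.ne'
  have key : ∀ R ∈ Set.Ioi (1 / c),
      fderiv ℝ U ((R - 1) / R, 1 / (c * R))
        ((R - 1) / R ^ 3, -(c * R - 1) / (c ^ 2 * R ^ 3)) = s R := by
    intro R hR
    have hR0 : 0 < R := lt_trans (by positivity) hR
    have hRne : R ≠ 0 := hR0.ne'
    have e1 : R * (R - 1) + R = R ^ 2 := by ring
    have e2 : R * (c * R - 1) + R = c * R ^ 2 := by ring
    have d1 : HasDerivAt (fun Rm : ℝ => Rm * (R - 1) / (Rm * (R - 1) + R))
        ((R - 1) / R ^ 3) R := by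
      have hn : HasDerivAt (fun Rm : ℝ => Rm * (R - 1)) (R - 1) R := by
        simpa using (hasDerivAt_id R).mul_const (R - 1)
      have := hn.fun_div (hn.add_const R) (by rw [e1]; positivity)
      refine this.congr_deriv ?_
      rw [e1]
      field_simp
      ring
    have d2 : HasDerivAt (fun Rm : ℝ => R / (Rm * (c * R - 1) + R))
        (-(c * R - 1) / (c ^ 2 * R ^ 3)) R := by
      have hn : HasDerivAt (fun Rm : ℝ => Rm * (c * R - 1)) (c * R - 1) R := by
        simpa using (hasDerivAt_id R).mul_const (c * R - 1)
      have := (hasDerivAt_const R R).fun_div (hn.add_const R) (by rw [e2]; positivity)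
      refine this.congr_deriv ?_
      rw [e2]
      field_simp
      ring
    have hp : (R * (R - 1) / (R * (R - 1) + R), R / (R * (c * R - 1) + R))
        = ((R - 1) / R, 1 / (c * R)) := by
      rw [e1, e2]
      ext
      · simp only
        field_simp
      · simp only
        field_simp
    have hd := ((hU.differentiable one_ne_zero) (R * (R - 1) / (R * (R - 1) + R),
      R / (R * (c * R - 1) + R))).hasFDerivAt.comp_hasDerivAt R (d1.prodMk d2)
    rw [hp] at hd
    exact hd.deriv.symm
  refine Filter.Tendsto.congr' (Filter.eventually_of_mem self_mem_nhdsWithin key) ?_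
  have hi : (1 / c : ℝ) ≠ 0 := by positivity
  have hcont : ContinuousAt (fun R : ℝ => fderiv ℝ U ((R - 1) / R, 1 / (c * R))
        ((R - 1) / R ^ 3, -(c * R - 1) / (c ^ 2 * R ^ 3))) (1 / c) := by
    have hf : Continuous (fderiv ℝ U) := hU.continuous_fderiv one_ne_zero
    have a1 : ContinuousAt (fun R : ℝ => ((R - 1) / R, 1 / (c * R))) (1 / c) := by
      refine ContinuousAt.prodMk ?_ ?_
      · exact ContinuousAt.div (by fun_prop) (by fun_prop) hi
      · exact ContinuousAt.div (by fun_prop) (by fun_prop) (mul_ne_zero hc0 hi)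
    have a2 : ContinuousAt (fun R : ℝ =>
        ((R - 1) / R ^ 3, -(c * R - 1) / (c ^ 2 * R ^ 3))) (1 / c) := by
      refine ContinuousAt.prodMk ?_ ?_
      · exact ContinuousAt.div (by fun_prop) (by fun_prop) (pow_ne_zero 3 hi)
      · exact ContinuousAt.div (by fun_prop) (by fun_prop)
          (mul_ne_zero (pow_ne_zero 2 hc0) (pow_ne_zero 3 hi))
    exact (ContinuousAt.comp' (f := fun R : ℝ => ((R - 1) / R, 1 / (c * R)))
      hf.continuousAt a1).clm_apply a2
  have ht := hcont.tendsto.mono_left (nhdsWithin_le_nhds (s := Set.Ioi (1 / c)))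
  have v1 : (1 / c - 1) / (1 / c) = 1 - c := by field_simp
  have v2 : 1 / (c * (1 / c)) = 1 := by field_simp
  have v3 : ((1 / c - 1) / (1 / c) ^ 3, -(c * (1 / c) - 1) / (c ^ 2 * (1 / c) ^ 3))
      = (c ^ 2 * (1 - c)) • ((1, 0) : ℝ × ℝ) := by
    ext
    · simp only [Prod.smul_fst, smul_eq_mul]
      field_simp
    · simp [hc0]
  rw [v1, v2, v3, map_smul, smul_eq_mul] at ht
  exact ht
end

section
/- Fix c > 0 and a continuously differentiable U : ℝ² → ℝ, and define the monomorphic utility V(ρ) = U(1 − 1/ρ, 1/(c·ρ)) on the interval Jc = (max(1, 1/c), ∞). Suppose that on Jc the map ρ ↦ ∂₁U(1 − 1/ρ, 1/(c·ρ)) is nonincreasing and the map ρ ↦ ∂₂U(1 − 1/ρ, 1/(c·ρ)) is nondecreasing, with at least one of these strictly monotone. Then ρ ↦ ρ²·V′(ρ) = ∂₁U(1 − 1/ρ, 1/(c·ρ)) − (1/c)·∂₂U(1 − 1/ρ, 1/(c·ρ)) is strictly decreasing on Jc; consequently V′ has at most one zero in Jc, is positive to its left and negative to its right, and V has at most one local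 maximum in Jc. -/
/-- Uniqueness of the interior social optimum for general utilities: if along
the monomorphic equilibria `(1 − 1/ρ, 1/(c·ρ))` the partial derivative
`∂₁U` is nonincreasing and `∂₂U` is nondecreasing in `ρ` on
`Jc = (max(1, 1/c), ∞)`, with at least one strictly monotone, then
`ρ ↦ ρ²·V'(ρ) = ∂₁U − (1/c)·∂₂U` is strictly decreasing on `Jc`; hence `V'`
has at most one zero in `Jc`, is positive to its left and negative to its
right, and `V` has at most one local maximum in `Jc`. -/
theorem unique_interior_social_optimum (c : ℝ) (hc : 0 < c)
    (U : ℝ × ℝ → ℝ) (hU : ContDiff ℝ 1 U) :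
    let Jc : Set ℝ := Set.Ioi (max 1 (1 / c))
    let V : ℝ → ℝ := fun ρ => U (1 - 1 / ρ, 1 / (c * ρ))
    let P1 : ℝ → ℝ := fun ρ => fderiv ℝ U (1 - 1 / ρ, 1 / (c * ρ)) ((1, 0) : ℝ × ℝ)
    let P2 : ℝ → ℝ := fun ρ => fderiv ℝ U (1 - 1 / ρ, 1 / (c * ρ)) ((0, 1) : ℝ × ℝ)
    AntitoneOn P1 Jc → MonotoneOn P2 Jc →
    (StrictAntiOn P1 Jc ∨ StrictMonoOn P2 Jc) →
    ((∀ ρ ∈ Jc, ρ ^ 2 * deriv V ρ = P1 ρ - (1 / c) * P2 ρ) ∧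
     StrictAntiOn (fun ρ => ρ ^ 2 * deriv V ρ) Jc ∧
     (∀ ρ₁ ∈ Jc, ∀ ρ₂ ∈ Jc, deriv V ρ₁ = 0 → deriv V ρ₂ = 0 → ρ₁ = ρ₂) ∧
     (∀ ρ₀ ∈ Jc, deriv V ρ₀ = 0 →
       (∀ ρ ∈ Jc, ρ < ρ₀ → 0 < deriv V ρ) ∧ (∀ ρ ∈ Jc, ρ₀ < ρ → deriv V ρ < 0)) ∧
     (∀ ρ₁ ∈ Jc, ∀ ρ₂ ∈ Jc, IsLocalMax V ρ₁ → IsLocalMax V ρ₂ → ρ₁ = ρ₂)) := by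
  intro Jc V P1 P2 h1 h2 h3
  have hpos : ∀ ρ ∈ Jc, 0 < ρ := fun ρ hρ =>
    lt_trans zero_lt_one (lt_of_le_of_lt (le_max_left _ _) hρ)
  have hc' : 0 < 1 / c := by positivity
  have hA : ∀ ρ ∈ Jc, ρ ^ 2 * deriv V ρ = P1 ρ - (1 / c) * P2 ρ := by
    intro ρ hρ
    have h0 := hpos ρ hρ
    have hne : ρ ≠ 0 := h0.ne'
    have hcne : c ≠ 0 := hc.ne'
    have hinv := hasDerivAt_inv hne
    have e1 : HasDerivAt (fun x : ℝ => 1 - 1 / x) (1 / ρ ^ 2) ρ := by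
      have h := hinv.const_sub 1
      simp only [one_div]
      refine h.congr_deriv ?_
      field_simp
    have e2 : HasDerivAt (fun x : ℝ => 1 / (c * x)) (-(1 / c) * (1 / ρ ^ 2)) ρ := by
      have h := hinv.const_mul (1 / c)
      have hf : (fun x : ℝ => 1 / (c * x)) = fun x => (1 / c) * x⁻¹ := by
        funext x
        simp [mul_comm]
      rw [hf]
      refine h.congr_deriv ?_
      field_simp
    have hd := (hU.differentiable one_ne_zero (1 - 1 / ρ, 1 / (c * ρ))).hasFDerivAt
    have hV : HasDerivAt V (fderiv ℝ U (1 - 1 / ρ, 1 / (c * ρ))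
        (1 / ρ ^ 2, -(1 / c) * (1 / ρ ^ 2))) ρ :=
      HasFDerivAt.comp_hasDerivAt (f := fun x : ℝ => (1 - 1 / x, 1 / (c * x))) ρ hd
        (e1.prodMk e2)
    have hvec : ((1 / ρ ^ 2, -(1 / c) * (1 / ρ ^ 2)) : ℝ × ℝ)
        = (1 / ρ ^ 2) • (1, 0) + (-(1 / c) * (1 / ρ ^ 2)) • (0, 1) := by
      ext <;> simp
    rw [hV.deriv, hvec, map_add, map_smul, map_smul, smul_eq_mul, smul_eq_mul]
    change ρ ^ 2 * (1 / ρ ^ 2 * P1 ρ + -(1 / c) * (1 / ρ ^ 2) * P2 ρ) = _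
    field_simp
    try ring
  have hB : StrictAntiOn (fun ρ => ρ ^ 2 * deriv V ρ) Jc := by
    intro a ha b hb hab
    simp only
    rw [hA a ha, hA b hb]
    have i1 := h1 ha hb hab.le
    have i2 := mul_le_mul_of_nonneg_left (h2 ha hb hab.le) hc'.le
    rcases h3 with h | h
    · have := h ha hb hab
      linarith
    · have := mul_lt_mul_of_pos_left (h ha hb hab) hc'
      linarith
  have hC : ∀ ρ₁ ∈ Jc, ∀ ρ₂ ∈ Jc, deriv V ρ₁ = 0 → deriv V ρ₂ = 0 → ρ₁ = ρ₂ := by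
    intro a ha b hb h h'
    apply hB.injOn ha hb
    simp [h, h']
  refine ⟨hA, hB, hC, ?_, ?_⟩
  · intro a ha h
    refine ⟨fun b hb hab => ?_, fun b hb hab => ?_⟩
    · have := hB hb ha hab
      simp only [h, mul_zero] at this
      have hp := hpos b hb
      exact (mul_pos_iff_of_pos_left (by positivity)).1 this
    · have := hB ha hb hab
      simp only [h, mul_zero] at this
      have hp := hpos b hb
      exact (pos_iff_neg_of_mul_neg this).1 (by positivity)
  · intro a ha b hb h h'
    exact hC a ha b hb h.deriv_eq_zero h'.deriv_eq_zero
end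

section
/- Let α ∈ (0,1) and c > 0, and let V be the linear monomorphic utility. (i) If α·c < 1 − α, then V(R) ≤ V(1/c) for all R > 0, and if moreover c < 1 then R = 1/c is the unique maximizer of V. (ii) If α·c > 1 − α, then V is strictly increasing on (max(1, 1/c), ∞) with V(R) → α as R → ∞; if in addition α > 1/2, then sup_{R>0} V(R) = α and this supremum is not attained. -/
/-- The linear monomorphic utility: `V(R) = 1 − α` for `R ≤ min(1, 1/c)`;
`V(R) = α·(1 − 1/R) + (1 − α)` for `1 < R ≤ 1/c`;
`V(R) = (1 − α)/(c·R)` for `1/c < R ≤ 1`; and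
`V(R) = α·(1 − 1/R) + (1 − α)/(c·R)` for `R > max(1, 1/c)`. -/
noncomputable def linearMonomorphicUtility (α c R : ℝ) : ℝ :=
  if R ≤ 1 then
    (if R ≤ 1 / c then 1 - α else (1 - α) / (c * R))
  else
    (if R ≤ 1 / c then α * (1 - 1 / R) + (1 - α)
     else α * (1 - 1 / R) + (1 - α) / (c * R))

lemma linearMonomorphicUtility_eq (α c R : ℝ) (hc : 0 < c) (hR : 0 < R) :
    linearMonomorphicUtility α c R =
      if 1 ≤ R⁻¹ then (if c ≤ R⁻¹ then 1 - α else (1 - α) * c⁻¹ * R⁻¹)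
      else (if c ≤ R⁻¹ then α * (1 - R⁻¹) + (1 - α)
        else α + ((1 - α) * c⁻¹ - α) * R⁻¹) := by
  have h1 : R ≤ 1 ↔ 1 ≤ R⁻¹ := by
    rw [le_inv_comm₀ one_pos hR, inv_one]
  have h2 : R ≤ 1 / c ↔ c ≤ R⁻¹ := by
    rw [le_inv_comm₀ hc hR, one_div]
  unfold linearMonomorphicUtility
  simp only [h1, h2]
  split_ifs
  · rfl
  · field_simp
  · rw [one_div]
  · field_simp
    ring

lemma linearMonomorphicUtility_large (α c R : ℝ) (hc : 0 < c) (hR : max 1 (1 / c) < R) :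
    linearMonomorphicUtility α c R = α + ((1 - α) * c⁻¹ - α) * R⁻¹ := by
  obtain ⟨h1, h2⟩ := max_lt_iff.1 hR
  have h0 : 0 < R := by linarith
  unfold linearMonomorphicUtility
  rw [if_neg (not_le.2 h1), if_neg (not_le.2 h2)]
  field_simp
  ring

/-- Social optima for the linear monomorphic utility: (i) if `α·c < 1 − α`
then `V` is maximized at `R = 1/c`, uniquely so when moreover `c < 1`;
(ii) if `α·c > 1 − α` then `V` is strictly increasing on `(max(1,1/c), ∞)`
with `V(R) → α` as `R → ∞`, and if additionally `α > 1/2` then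
`sup_{R>0} V(R) = α` and the supremum is not attained. -/
theorem linear_utility_social_optimum (α c : ℝ)
    (hα : α ∈ Set.Ioo (0 : ℝ) 1) (hc : 0 < c) :
    (α * c < 1 - α →
      (∀ R : ℝ, 0 < R →
        linearMonomorphicUtility α c R ≤ linearMonomorphicUtility α c (1 / c)) ∧
      (c < 1 → ∀ R : ℝ, 0 < R → R ≠ 1 / c →
        linearMonomorphicUtility α c R < linearMonomorphicUtility α c (1 / c))) ∧
    (1 - α < α * c →
      StrictMonoOn (linearMonomorphicUtility α c) (Set.Ioi (max 1 (1 / c))) ∧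
      Filter.Tendsto (linearMonomorphicUtility α c) Filter.atTop (nhds α) ∧
      (1 / 2 < α →
        IsLUB (linearMonomorphicUtility α c '' Set.Ioi (0 : ℝ)) α ∧
        ∀ R : ℝ, 0 < R → linearMonomorphicUtility α c R < α)) := by
  obtain ⟨ha0, ha1⟩ := hα
  have hd : 0 < c⁻¹ := inv_pos.2 hc
  have hcd : c * c⁻¹ = 1 := mul_inv_cancel₀ hc.ne'
  refine ⟨fun h => ?_, fun h => ?_⟩
  · have hk : 0 < (1 - α) * c⁻¹ - α := by
      have : (1 - α) * c⁻¹ - α = (1 - α - α * c) * c⁻¹ := by linear_combination α * hcd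
      rw [this]
      exact mul_pos (by linarith) hd
    have hV : linearMonomorphicUtility α c (1 / c) =
        if 1 ≤ c then 1 - α else 1 - α * c := by
      rw [linearMonomorphicUtility_eq α c _ hc (by positivity)]
      simp only [one_div, inv_inv, le_refl, if_true]
      split_ifs <;> ring
    refine ⟨fun R hR => ?_, fun hc1 R hR hne => ?_⟩
    · rw [hV, linearMonomorphicUtility_eq α c R hc hR]
      have hu : 0 < R⁻¹ := inv_pos.2 hR
      generalize R⁻¹ = u at *
      split_ifs with h1 h2 h3 h4 h5 h6 h7
      all_goals try push Not at *
      all_goals first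
        | linarith
        | nlinarith
    · have hne' : R⁻¹ ≠ c := fun h => hne (by rw [← h]; simp)
      rw [hV, linearMonomorphicUtility_eq α c R hc hR, if_neg (not_le.2 hc1)]
      have hu : 0 < R⁻¹ := inv_pos.2 hR
      generalize R⁻¹ = u at *
      split_ifs with h1 h2 h3
      · nlinarith
      · exact absurd (hc1.le.trans h1) h2
      · have : c < u := lt_of_le_of_ne h3 hne'.symm
        nlinarith
      · push Not at *
        nlinarith [mul_lt_mul_of_pos_left h3 hk]
  · have hk : 0 < α - (1 - α) * c⁻¹ := by
      have : α - (1 - α) * c⁻¹ = (α * c - (1 - α)) * c⁻¹ := by linear_combination -α * hcd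
      rw [this]
      exact mul_pos (by linarith) hd
    have hT : Filter.Tendsto (linearMonomorphicUtility α c) Filter.atTop (nhds α) := by
      have h1 : Filter.Tendsto (fun R : ℝ => α + ((1 - α) * c⁻¹ - α) * R⁻¹)
          Filter.atTop (nhds (α + ((1 - α) * c⁻¹ - α) * 0)) :=
        (tendsto_inv_atTop_zero.const_mul _).const_add _
      rw [mul_zero, add_zero] at h1
      refine h1.congr' ?_
      filter_upwards [Filter.eventually_gt_atTop (max 1 (1 / c))] with R hR
      exact (linearMonomorphicUtility_large α c R hc hR).symm
    refine ⟨?_, hT, fun h2 => ?_⟩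
    · intro x hx y hy hxy
      rw [linearMonomorphicUtility_large α c x hc hx, linearMonomorphicUtility_large α c y hc hy]
      have hx0 : 0 < x := lt_of_lt_of_le one_pos ((le_max_left _ _).trans (le_of_lt hx))
      have := inv_strictAnti₀ hx0 hxy
      nlinarith
    · have hlt : ∀ R : ℝ, 0 < R → linearMonomorphicUtility α c R < α := by
        intro R hR
        rw [linearMonomorphicUtility_eq α c R hc hR]
        have hu : 0 < R⁻¹ := inv_pos.2 hR
        generalize R⁻¹ = u at *
        split_ifs with h3 h4 h5
        · linarith
        · push Not at h4
          nlinarith [mul_lt_mul_of_pos_left h4 (mul_pos (sub_pos.2 ha1) hd)]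
        · nlinarith
        · nlinarith
      refine ⟨⟨?_, ?_⟩, hlt⟩
      · rintro _ ⟨R, hR, rfl⟩
        exact (hlt R hR).le
      · intro b hb
        refine le_of_tendsto hT ?_
        filter_upwards [Filter.eventually_gt_atTop 0] with R hR
        exact hb ⟨R, hR, rfl⟩
end

section
/- Fix α ∈ (0,1) and c ∈ (0,1) with α·c < 1 − α, and let R > 1/c be a resident reproduction number. The derivative at Rm = R of the linear utility Rm ↦ α·Îg(Rm, R) + (1−α)·Ŝb(Rm, R) equals g(R) := (1/(c²·R³))·((α·c + α − 1)·c·R + 1 − α − α·c²). Moreover, g has a unique zero on (1/c, ∞), namely R_int = 1 + (1−α)·(1−c)/(c·(1 − α − α·c)), and g(R) > 0 for 1/c < R < R_int while g(R) < 0 for R > R_int; in particular R_int > 1/c is the unique evolutionarily singular sociality strategy in this regime. -/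
/-- The local selection gradient under linear utility.  Fix `α ∈ (0,1)`,
`c ∈ (0,1)` with `α·c < 1 − α`, and a resident `R > 1/c`.  The derivative at
`Rm = R` of the rare-mutant linear utility `α·Îg(Rm,R) + (1−α)·Ŝb(Rm,R)`
equals `g(R) = (1/(c²·R³))·((α·c + α − 1)·c·R + 1 − α − α·c²)`; moreover `g`
has the unique zero `R_int = 1 + (1−α)·(1−c)/(c·(1 − α − α·c))` on
`(1/c, ∞)`, with `g > 0` on `(1/c, R_int)`, `g < 0` on `(R_int, ∞)`, and
`R_int > 1/c`. -/
theorem linear_utility_selection_gradient (α c R : ℝ)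
    (hα : α ∈ Set.Ioo (0 : ℝ) 1) (hc : c ∈ Set.Ioo (0 : ℝ) 1)
    (hcond : α * c < 1 - α) (hR : 1 / c < R) :
    let g : ℝ → ℝ := fun R =>
      (1 / (c ^ 2 * R ^ 3)) * ((α * c + α - 1) * c * R + 1 - α - α * c ^ 2)
    let Rint : ℝ := 1 + (1 - α) * (1 - c) / (c * (1 - α - α * c))
    HasDerivAt (fun Rm : ℝ =>
        α * (Rm * (R - 1) / (Rm * (R - 1) + R)) +
          (1 - α) * (R / (Rm * (c * R - 1) + R))) (g R) R ∧
    g Rint = 0 ∧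
    (∀ R' : ℝ, 1 / c < R' → R' < Rint → 0 < g R') ∧
    (∀ R' : ℝ, Rint < R' → g R' < 0) ∧
    (∀ R' : ℝ, 1 / c < R' → g R' = 0 → R' = Rint) ∧
    1 / c < Rint := by
  intro g Rint
  obtain ⟨hα0, hα1⟩ := hα
  obtain ⟨hc0, hc1⟩ := hc
  have hD : 0 < 1 - α - α * c := by linarith
  have hcD : 0 < c * (1 - α - α * c) := mul_pos hc0 hD
  have hci : 0 < 1 / c := by positivity
  have hlin : Rint * (c * (1 - α - α * c)) = 1 - α - α * c ^ 2 := by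
    have h : Rint * (c * (1 - α - α * c))
        = c * (1 - α - α * c) + (1 - α) * (1 - c) := by
      simp only [Rint]
      rw [add_mul, div_mul_cancel₀ _ hcD.ne', one_mul]
    rw [h]; ring
  have hg : ∀ x, g x = (1 / (c ^ 2 * x ^ 3)) * (c * (1 - α - α * c) * (Rint - x)) := by
    intro x
    simp only [g]
    congr 1
    linear_combination -hlin
  have hint : 1 / c < Rint := by
    rw [div_lt_iff₀ hc0]
    have h2 : (1 - α - α * c) * 1 < (1 - α - α * c) * (Rint * c) := by
      nlinarith [mul_pos (mul_pos hα0 hc0) (sub_pos.2 hc1)]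
    exact lt_of_mul_lt_mul_left h2 hD.le
  have hpos : ∀ x, 1 / c < x → 0 < 1 / (c ^ 2 * x ^ 3) := by
    intro x hx
    have : 0 < x := hci.trans hx
    positivity
  refine ⟨?_, ?_, ?_, ?_, ?_, hint⟩
  · have hR0 : 0 < R := hci.trans hR
    have e1 : R * (R - 1) + R = R ^ 2 := by ring
    have e2 : R * (c * R - 1) + R = c * R ^ 2 := by ring
    have n1 : R * (R - 1) + R ≠ 0 := by rw [e1]; positivity
    have n2 : R * (c * R - 1) + R ≠ 0 := by rw [e2]; positivity
    have d1 : HasDerivAt (fun x : ℝ => x * (R - 1)) (1 * (R - 1)) R :=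
      (hasDerivAt_id R).mul_const _
    have d2 : HasDerivAt (fun x : ℝ => x * (c * R - 1) + R) (1 * (c * R - 1)) R :=
      ((hasDerivAt_id R).mul_const _).add_const _
    have d := ((d1.div (d1.add_const R) n1).const_mul α).add
      (((hasDerivAt_const R R).div d2 n2).const_mul (1 - α))
    refine d.congr_deriv ?_
    simp only [g]
    rw [e1, e2]
    field_simp
    ring
  · rw [hg]; simp
  · intro x hx hx2
    rw [hg]
    exact mul_pos (hpos x hx) (mul_pos hcD (sub_pos.2 hx2))
  · intro x hx
    rw [hg]
    exact mul_neg_of_pos_of_neg (hpos x (hint.trans hx))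
      (mul_neg_of_pos_of_neg hcD (sub_neg.2 hx))
  · intro x hx h
    rw [hg] at h
    have h1 := (mul_eq_zero.1 h).resolve_left (hpos x hx).ne'
    have h2 := (mul_eq_zero.1 h1).resolve_left hcD.ne'
    linarith
end
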